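/- arXiv:2212.13226 — 2 statements merged into one kernel-verified Lean document; each statement's English description precedes it below -/
import Mathlib

section
/- (Theorem 2, inverse-probability-weighting identification.) Under the DiD identification setup, the ATEM is identified by the IPW estimand: E[Yobs_t − Y⁰_t ∣ M] = E[(1_M / P(M) − r · 1_S / E[r · 1_S]) · ΔY]. -/
open MeasureTheory

/-- The generalized propensity score `p = E[1_M ∣ ℋ] / (E[1_M ∣ ℋ] + E[1_S ∣ ℋ])`. -/
noncomputable def gps {Ω : Type*} {𝔉 : MeasurableSpace Ω} (P : Measure Ω)
    (ℋ : MeasurableSpace Ω) (M S : Set Ω) : Ω → ℝ := fun ω =>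
  (P[M.indicator (fun _ => (1 : ℝ)) | ℋ]) ω /
    ((P[M.indicator (fun _ => (1 : ℝ)) | ℋ]) ω + (P[S.indicator (fun _ => (1 : ℝ)) | ℋ]) ω)

/-- The odds ratio `r = p / (1 − p)` of the generalized propensity score. -/
noncomputable def gpsOdds {Ω : Type*} {𝔉 : MeasurableSpace Ω} (P : Measure Ω)
    (ℋ : MeasurableSpace Ω) (M S : Set Ω) : Ω → ℝ := fun ω =>
  gps P ℋ M S ω / (1 - gps P ℋ M S ω)

section Helpers

variable {Ω : Type*} {m𝔉 : MeasurableSpace Ω} {P : Measure Ω}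

/-- Conditional expectation is self-adjoint against functions measurable for the smaller
σ-algebra. -/
lemma integral_mul_condExp_of_stronglyMeasurable {𝒢 : MeasurableSpace Ω} (h𝒢 : 𝒢 ≤ m𝔉)
    [SigmaFinite (P.trim h𝒢)] {f g : Ω → ℝ} (hf : StronglyMeasurable[𝒢] f)
    (hfg : Integrable (f * g) P) (hg : Integrable g P) :
    ∫ ω, f ω * (P[g | 𝒢]) ω ∂P = ∫ ω, f ω * g ω ∂P := by
  calc ∫ ω, f ω * (P[g | 𝒢]) ω ∂P = ∫ ω, (P[f * g | 𝒢]) ω ∂P :=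
        integral_congr_ae (condExp_mul_of_stronglyMeasurable_left hf hfg hg).symm
    _ = ∫ ω, f ω * g ω ∂P := integral_condExp h𝒢

lemma condExp_indicator_one_nonneg (ℋ : MeasurableSpace Ω) (A : Set Ω) :
    ∀ᵐ ω ∂P, 0 ≤ (P[A.indicator (fun _ => (1 : ℝ)) | ℋ]) ω :=
  condExp_nonneg (.of_forall fun _ => Set.indicator_nonneg (fun _ _ => zero_le_one) _)

/-- Two σ-algebras giving the same conditional mean to every one-period increment give the same
conditional mean to the long difference. -/
lemma condExp_sub_ae_eq_of_increments {𝒢 ℋ : MeasurableSpace Ω} {s t : ℕ} (hst : s ≤ t)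
    {Y : ℕ → Ω → ℝ} (hY : ∀ r, s ≤ r → r ≤ t → Integrable (Y r) P)
    (h : ∀ r, s < r → r ≤ t →
      P[fun ω => Y r ω - Y (r - 1) ω | 𝒢] =ᵐ[P] P[fun ω => Y r ω - Y (r - 1) ω | ℋ]) :
    P[Y t - Y s | 𝒢] =ᵐ[P] P[Y t - Y s | ℋ] := by
  induction t, hst using Nat.le_induction with
  | base => simp
  | succ n hn ih =>
    have hstep := h (n + 1) (by omega) le_rfl
    have hIH := ih (fun r h1 h2 => hY r h1 (by omega)) (fun r h1 h2 => h r h1 (by omega))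
    have hYs := hY s le_rfl (by omega)
    have hYn := hY n hn (by omega)
    have hYn1 := hY (n + 1) (by omega) le_rfl
    have hsplit : Y (n + 1) - Y s = (Y (n + 1) - Y n) + (Y n - Y s) := by abel
    rw [hsplit]
    exact (condExp_add (hYn1.sub hYn) (hYn.sub hYs) 𝒢).trans
      ((hstep.add hIH).trans (condExp_add (hYn1.sub hYn) (hYn.sub hYs) ℋ).symm)

lemma stronglyMeasurable_gpsOdds (P : Measure Ω) (ℋ : MeasurableSpace Ω) (M S : Set Ω) :
    StronglyMeasurable[ℋ] (gpsOdds P ℋ M S) := by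
  have hcond (A : Set Ω) : Measurable[ℋ] (P[A.indicator (fun _ => (1 : ℝ)) | ℋ]) :=
    stronglyMeasurable_condExp.measurable
  have hp : Measurable[ℋ] (gps P ℋ M S) := (hcond M).div ((hcond M).add (hcond S))
  exact (hp.div (hp.const_sub 1)).stronglyMeasurable

lemma norm_gpsOdds_le {ℋ : MeasurableSpace Ω} {M S : Set Ω} {ε : ℝ} (hε : 0 < ε) {ω : Ω}
    (h : ε ≤ gps P ℋ M S ω ∧ gps P ℋ M S ω ≤ 1 - ε) :
    ‖gpsOdds P ℋ M S ω‖ ≤ 1 / ε := by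
  obtain ⟨h1, h2⟩ := h
  unfold gpsOdds
  rw [Real.norm_of_nonneg (div_nonneg (by linarith) (by linarith))]
  exact div_le_div₀ zero_le_one (by linarith) hε (by linarith)

lemma gpsOdds_mul_condExp {ℋ : MeasurableSpace Ω} {M S : Set Ω} {ω : Ω}
    (hM : 0 ≤ (P[M.indicator (fun _ => (1 : ℝ)) | ℋ]) ω)
    (hS : 0 < (P[S.indicator (fun _ => (1 : ℝ)) | ℋ]) ω) :
    gpsOdds P ℋ M S ω * (P[S.indicator (fun _ => (1 : ℝ)) | ℋ]) ω
      = (P[M.indicator (fun _ => (1 : ℝ)) | ℋ]) ω := by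
  unfold gpsOdds gps
  generalize (P[M.indicator (fun _ => (1 : ℝ)) | ℋ]) ω = a at *
  generalize (P[S.indicator (fun _ => (1 : ℝ)) | ℋ]) ω = b at *
  have hab : a + b ≠ 0 := by positivity
  have h1 : 1 - a / (a + b) = b / (a + b) := by field_simp; ring
  rw [h1]
  field_simp

/-- Reweighting stayers by the odds ratio reproduces the movers' mean of any variable whose
conditional mean given the covariates does not depend on treatment. -/
lemma integral_gpsOdds_mul_indicator_mul [IsProbabilityMeasure P]
    {ℋ 𝒟σ : MeasurableSpace Ω} (hℋ : ℋ ≤ m𝔉) (h𝒟 : 𝒟σ ≤ m𝔉) {M S : Set Ω}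
    (hM : MeasurableSet[𝒟σ] M) (hS : MeasurableSet[𝒟σ] S) {ε : ℝ} (hε : 0 < ε)
    (hoverS : ∀ᵐ ω ∂P, ε ≤ (P[S.indicator (fun _ => (1 : ℝ)) | ℋ]) ω)
    (hoverp : ∀ᵐ ω ∂P, ε ≤ gps P ℋ M S ω ∧ gps P ℋ M S ω ≤ 1 - ε)
    {W : Ω → ℝ} (hW : Integrable W P) (hpt : P[W | 𝒟σ ⊔ ℋ] =ᵐ[P] P[W | ℋ]) :
    ∫ ω, gpsOdds P ℋ M S ω * S.indicator (fun _ => (1 : ℝ)) ω * W ω ∂P = ∫ ω in M, W ω ∂P := by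
  have hsup : 𝒟σ ⊔ ℋ ≤ m𝔉 := sup_le h𝒟 hℋ
  set r := gpsOdds P ℋ M S
  set w := P[W | ℋ]
  set iM : Ω → ℝ := M.indicator fun _ => 1
  set iS : Ω → ℝ := S.indicator fun _ => 1
  have hr : StronglyMeasurable[ℋ] r := stronglyMeasurable_gpsOdds P ℋ M S
  have hrb : ∀ᵐ ω ∂P, ‖r ω‖ ≤ 1 / ε := hoverp.mono fun ω h => norm_gpsOdds_le hε h
  have hw : StronglyMeasurable[ℋ] w := stronglyMeasurable_condExp
  have hwi : Integrable w P := integrable_condExp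
  have hind {A : Set Ω} (hA : MeasurableSet[𝒟σ] A) :
      StronglyMeasurable[𝒟σ] (A.indicator fun _ => (1 : ℝ)) :=
    stronglyMeasurable_const.indicator hA
  have hindb (A : Set Ω) : ∀ᵐ ω ∂P, ‖A.indicator (fun _ => (1 : ℝ)) ω‖ ≤ 1 :=
    .of_forall fun ω => by by_cases h : ω ∈ A <;> simp [h]
  have hiM : StronglyMeasurable[𝒟σ] iM := hind hM
  have hiS : StronglyMeasurable[𝒟σ] iS := hind hS
  have hiMi : Integrable iM P := (integrable_const 1).indicator (h𝒟 _ hM)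
  have hiSi : Integrable iS P := (integrable_const 1).indicator (h𝒟 _ hS)
  have hmulM {V : Ω → ℝ} (hV : Integrable V P) : Integrable (iM * V) P :=
    hV.bdd_mul (hiM.mono h𝒟).aestronglyMeasurable (hindb M)
  have hmulS {V : Ω → ℝ} (hV : Integrable V P) : Integrable (iS * V) P :=
    hV.bdd_mul (hiS.mono h𝒟).aestronglyMeasurable (hindb S)
  have hmulr {V : Ω → ℝ} (hV : Integrable V P) : Integrable (r * V) P :=
    hV.bdd_mul (hr.mono hℋ).aestronglyMeasurable hrb
  have hriS : StronglyMeasurable[𝒟σ ⊔ ℋ] (r * iS) :=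
    (hr.mono le_sup_right).mul (hiS.mono le_sup_left)
  calc ∫ ω, r ω * iS ω * W ω ∂P
      = ∫ ω, (r * iS) ω * (P[W | 𝒟σ ⊔ ℋ]) ω ∂P :=
        (integral_mul_condExp_of_stronglyMeasurable hsup hriS
          (by rw [mul_assoc]; exact hmulr (hmulS hW)) hW).symm
    _ = ∫ ω, (r * w) ω * iS ω ∂P := by
        refine integral_congr_ae (hpt.mono fun ω h => ?_)
        simp only [h, Pi.mul_apply]
        ring
    _ = ∫ ω, (r * w) ω * (P[iS | ℋ]) ω ∂P :=
        (integral_mul_condExp_of_stronglyMeasurable hℋ (hr.mul hw)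
          (by rw [mul_assoc, mul_comm w]; exact hmulr (hmulS hwi)) hiSi).symm
    _ = ∫ ω, w ω * (P[iM | ℋ]) ω ∂P := by
        refine integral_congr_ae ?_
        filter_upwards [hoverS, condExp_indicator_one_nonneg (P := P) ℋ M] with ω hSω hMω
        have := gpsOdds_mul_condExp hMω (hε.trans_le hSω)
        simp only [Pi.mul_apply]
        rw [← this]
        ring
    _ = ∫ ω, w ω * iM ω ∂P :=
        integral_mul_condExp_of_stronglyMeasurable hℋ hw
          (by rw [mul_comm]; exact hmulM hwi) hiMi
    _ = ∫ ω, iM ω * (P[W | 𝒟σ ⊔ ℋ]) ω ∂P :=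
        integral_congr_ae (hpt.mono fun ω h => by simp only [h]; ring)
    _ = ∫ ω, iM ω * W ω ∂P :=
        integral_mul_condExp_of_stronglyMeasurable hsup (hiM.mono le_sup_left) (hmulM hW) hW
    _ = ∫ ω in M, W ω ∂P := by
        rw [← integral_indicator (h𝒟 _ hM)]
        congr with ω
        by_cases h : ω ∈ M <;> simp [iM, h]

end Helpers


/-- Theorem 2 (inverse-probability-weighting identification): the ATEM is identified by the
IPW estimand `E[Yobs_t − Y⁰_t ∣ M] = E[(1_M / P(M) − r·1_S / E[r·1_S]) · ΔY]`. -/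
theorem atem_ipw_identification
    {Ω : Type*} {𝔉 : MeasurableSpace Ω} (P : Measure Ω) [IsProbabilityMeasure P]
    (s t : ℕ) (hst : s < t)
    (Y0 : ℕ → Ω → ℝ) (hY0int : ∀ r, s ≤ r → r ≤ t → Integrable (Y0 r) P)
    (Yobs_t Yobs_s : Ω → ℝ) (hYt : Integrable Yobs_t P) (hYs : Integrable Yobs_s P)
    (ℋ 𝒟σ : MeasurableSpace Ω) (hℋ : ℋ ≤ 𝔉) (h𝒟 : 𝒟σ ≤ 𝔉)
    (M S : Set Ω) (hM : MeasurableSet[𝒟σ] M) (hS : MeasurableSet[𝒟σ] S)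
    (hMS : Disjoint M S) (hPM : 0 < P M)
    (hcons_s : ∀ᵐ ω ∂P, ω ∈ M ∪ S → Yobs_s ω = Y0 s ω)
    (hcons_t : ∀ᵐ ω ∂P, ω ∈ S → Yobs_t ω = Y0 t ω)
    (hpt : ∀ r, s < r → r ≤ t →
      P[fun ω => Y0 r ω - Y0 (r - 1) ω | 𝒟σ ⊔ ℋ]
        =ᵐ[P] P[fun ω => Y0 r ω - Y0 (r - 1) ω | ℋ])
    (ε : ℝ) (hε : 0 < ε)
    (hoverS : ∀ᵐ ω ∂P, ε ≤ (P[S.indicator (fun _ => (1 : ℝ)) | ℋ]) ω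
        ∧ (P[S.indicator (fun _ => (1 : ℝ)) | ℋ]) ω ≤ 1 - ε)
    (hoverp : ∀ᵐ ω ∂P, ε ≤ gps P ℋ M S ω ∧ gps P ℋ M S ω ≤ 1 - ε)
    :
    (∫ ω in M, (Yobs_t ω - Y0 t ω) ∂P) / (P M).toReal
      = ∫ ω, (M.indicator (fun _ => (1 : ℝ)) ω / (P M).toReal
          - gpsOdds P ℋ M S ω * S.indicator (fun _ => (1 : ℝ)) ω
              / (∫ ω', gpsOdds P ℋ M S ω' * S.indicator (fun _ => (1 : ℝ)) ω' ∂P))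
          * (Yobs_t ω - Yobs_s ω) ∂P := by
  have hY0s := hY0int s le_rfl hst.le
  have hY0t := hY0int t hst.le le_rfl
  have hSε := hoverS.mono fun ω h => h.1
  have hW : Integrable (Y0 t - Y0 s) P := hY0t.sub hY0s
  have hden : ∫ ω, gpsOdds P ℋ M S ω * S.indicator (fun _ => (1 : ℝ)) ω ∂P = (P M).toReal := by
    have h := integral_gpsOdds_mul_indicator_mul hℋ h𝒟 hM hS hε hSε hoverp
      (integrable_const (1 : ℝ))
      (by rw [condExp_const (sup_le h𝒟 hℋ), condExp_const hℋ])
    simpa [Measure.real] using h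
  have hstay : ∫ ω, gpsOdds P ℋ M S ω * S.indicator (fun _ => (1 : ℝ)) ω
      * (Yobs_t ω - Yobs_s ω) ∂P = ∫ ω in M, (Y0 t ω - Yobs_s ω) ∂P := by
    calc ∫ ω, gpsOdds P ℋ M S ω * S.indicator (fun _ => (1 : ℝ)) ω * (Yobs_t ω - Yobs_s ω) ∂P
        = ∫ ω, gpsOdds P ℋ M S ω * S.indicator (fun _ => (1 : ℝ)) ω * (Y0 t - Y0 s) ω ∂P := by
          refine integral_congr_ae ?_
          filter_upwards [hcons_s, hcons_t] with ω hs ht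
          by_cases h : ω ∈ S
          · simp [hs (Or.inr h), ht h]
          · simp [h]
      _ = ∫ ω in M, (Y0 t - Y0 s) ω ∂P :=
          integral_gpsOdds_mul_indicator_mul hℋ h𝒟 hM hS hε hSε hoverp hW
            (condExp_sub_ae_eq_of_increments hst.le hY0int hpt)
      _ = ∫ ω in M, (Y0 t ω - Yobs_s ω) ∂P := by
          refine setIntegral_congr_ae (h𝒟 _ hM) ?_
          filter_upwards [hcons_s] with ω hs h
          simp [hs (Or.inl h)]
  have hΔ : Integrable (fun ω => Yobs_t ω - Yobs_s ω) P := hYt.sub hYs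
  have hmovers : ∫ ω, M.indicator (fun _ => (1 : ℝ)) ω * (Yobs_t ω - Yobs_s ω) ∂P
      = ∫ ω in M, (Yobs_t ω - Yobs_s ω) ∂P := by
    rw [← integral_indicator (h𝒟 _ hM)]
    congr with ω
    by_cases h : ω ∈ M <;> simp [h]
  have hY0tYs : Integrable (fun ω => Y0 t ω - Yobs_s ω) P := hY0t.sub hYs
  have hindi {A : Set Ω} (hA : MeasurableSet[𝒟σ] A) :
      Integrable (fun ω => A.indicator (fun _ => (1 : ℝ)) ω * (Yobs_t ω - Yobs_s ω)) P :=
    hΔ.bdd_mul (c := 1) ((stronglyMeasurable_const.indicator hA).mono h𝒟).aestronglyMeasurable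
      (.of_forall fun ω => by by_cases h : ω ∈ A <;> simp [h])
  have hstayi : Integrable (fun ω => gpsOdds P ℋ M S ω * S.indicator (fun _ => (1 : ℝ)) ω
      * (Yobs_t ω - Yobs_s ω)) P := by
    simp only [mul_assoc]
    exact (hindi hS).bdd_mul ((stronglyMeasurable_gpsOdds P ℋ M S).mono hℋ).aestronglyMeasurable
      (hoverp.mono fun ω h => norm_gpsOdds_le hε h)
  rw [hden]
  calc (∫ ω in M, (Yobs_t ω - Y0 t ω) ∂P) / (P M).toReal
      = (∫ ω in M, ((Yobs_t ω - Yobs_s ω) - (Y0 t ω - Yobs_s ω)) ∂P) / (P M).toReal := by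
        simp only [sub_sub_sub_cancel_right]
    _ = (∫ ω, M.indicator (fun _ => (1 : ℝ)) ω * (Yobs_t ω - Yobs_s ω) ∂P
          - ∫ ω, gpsOdds P ℋ M S ω * S.indicator (fun _ => (1 : ℝ)) ω
            * (Yobs_t ω - Yobs_s ω) ∂P) / (P M).toReal := by
        rw [integral_sub hΔ.integrableOn hY0tYs.integrableOn, hmovers, hstay]
    _ = _ := by
        rw [← integral_sub (hindi hM) hstayi, ← integral_div]
        congr with ω
        ring
end

section
/- (Theorem 3(i), double robustness with respect to the propensity model.) Under the DiD identification setup, suppose the outcome-regression function m is correctly specified (i.e., m is ℋ-measurable, integrable, and m · E[1_S ∣ ℋ] = E[1_S · ΔY ∣ ℋ] a.s.). Then for EVERY ℋ-measurable function p̃ : Ω → ℝ with ε' ≤ p̃ ≤ 1 − ε' almost surely for some ε' > 0 (an arbitrary, possibly misspecified, generalized propensity score), setting r̃ := p̃ / (1 − p̃), one has E[(1_M / P(M) − r̃ · 1_S / E[r̃ · 1_S]) · (ΔY − m)] = E[Yobs_t − Y⁰_t ∣ M]. -/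
open MeasureTheory

/-- A bounded `𝒢`-measurable weight is orthogonal to the prediction error `X - P[X|𝒢]`. -/
theorem integral_mul_sub_condExp_eq_zero {Ω : Type*} {𝔉 : MeasurableSpace Ω} {P : Measure Ω}
    [IsProbabilityMeasure P] {𝒢 : MeasurableSpace Ω} (h𝒢 : 𝒢 ≤ 𝔉) {X f k : Ω → ℝ}
    (hX : Integrable X P) (hf : Integrable f P) (hXf : P[X | 𝒢] =ᵐ[P] f)
    (hk : StronglyMeasurable[𝒢] k) {C : ℝ} (hC : ∀ᵐ ω ∂P, ‖k ω‖ ≤ C) :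
    ∫ ω, k ω * (X ω - f ω) ∂P = 0 := by
  have hk' : AEStronglyMeasurable[𝔉] k P := (hk.mono h𝒢).aestronglyMeasurable
  have hkX : Integrable (fun ω => k ω * X ω) P := hX.bdd_mul hk' hC
  have hkf : Integrable (fun ω => k ω * f ω) P := hf.bdd_mul hk' hC
  have key : ∫ ω, k ω * X ω ∂P = ∫ ω, k ω * f ω ∂P := by
    rw [← integral_condExp h𝒢]
    refine integral_congr_ae ?_
    have pull_out : P[fun ω => k ω * X ω | 𝒢] =ᵐ[P] k * P[X | 𝒢] :=
      condExp_mul_of_stronglyMeasurable_left hk hkX hX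
    filter_upwards [pull_out, hXf] with ω h1 h2
    rw [h1, Pi.mul_apply, h2]
  simp_rw [mul_sub]
  rw [integral_sub hkX hkf, key, sub_self]

/-- If every one-step increment has the same conditional expectation given `𝒢` and `ℋ`, then so
does the total increment. -/
theorem condExp_sub_eq_of_increments {Ω : Type*} {𝔉 : MeasurableSpace Ω} {P : Measure Ω}
    {𝒢 ℋ : MeasurableSpace Ω} {s t : ℕ} (hst : s ≤ t) {Y : ℕ → Ω → ℝ}
    (hY : ∀ r, s ≤ r → r ≤ t → Integrable (Y r) P)
    (hinc : ∀ r, s < r → r ≤ t →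
      P[fun ω => Y r ω - Y (r - 1) ω | 𝒢] =ᵐ[P] P[fun ω => Y r ω - Y (r - 1) ω | ℋ]) :
    P[fun ω => Y t ω - Y s ω | 𝒢] =ᵐ[P] P[fun ω => Y t ω - Y s ω | ℋ] := by
  induction t, hst using Nat.le_induction with
  | base =>
    have h0 : (fun ω => Y s ω - Y s ω) = (0 : Ω → ℝ) := by ext; simp
    rw [h0, condExp_zero, condExp_zero]
  | succ n hn ih =>
    have ih' := ih (fun r h1 h2 => hY r h1 (by omega)) (fun r h1 h2 => hinc r h1 (by omega))
    have hstep := hinc (n + 1) (by omega) le_rfl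
    rw [Nat.add_sub_cancel] at hstep
    have hsplit : (fun ω => Y (n + 1) ω - Y s ω)
        = (fun ω => Y (n + 1) ω - Y n ω) + (fun ω => Y n ω - Y s ω) := by
      ext; simp
    have hi1 : Integrable (fun ω => Y (n + 1) ω - Y n ω) P :=
      (hY _ (by omega) le_rfl).sub (hY _ hn (by omega))
    have hi2 : Integrable (fun ω => Y n ω - Y s ω) P :=
      (hY _ hn (by omega)).sub (hY _ le_rfl (by omega))
    rw [hsplit]
    exact (condExp_add hi1 hi2 𝒢).trans ((hstep.add ih').trans (condExp_add hi1 hi2 ℋ).symm)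

/-- If `X` is mean independent of `𝒢` given `ℋ ≤ 𝒢`, then for `S ∈ 𝒢` the conditional expectation
of `1_S * X` given `ℋ` factorizes. -/
theorem condExp_indicator_mul_of_meanIndep {Ω : Type*} {𝔉 : MeasurableSpace Ω} {P : Measure Ω}
    [IsProbabilityMeasure P] {𝒢 ℋ : MeasurableSpace Ω} (hℋ𝒢 : ℋ ≤ 𝒢) (h𝒢 : 𝒢 ≤ 𝔉)
    {X : Ω → ℝ} (hX : Integrable X P) (hXind : P[X | 𝒢] =ᵐ[P] P[X | ℋ])
    {S : Set Ω} (hS : MeasurableSet[𝒢] S) :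
    P[fun ω => S.indicator (fun _ => (1 : ℝ)) ω * X ω | ℋ]
      =ᵐ[P] fun ω => P[X | ℋ] ω * (P[S.indicator (fun _ => (1 : ℝ)) | ℋ]) ω := by
  have hSm : StronglyMeasurable[𝒢] (S.indicator (fun _ => (1 : ℝ))) :=
    stronglyMeasurable_const.indicator hS
  have hS1 : ∀ᵐ ω ∂P, ‖S.indicator (fun _ => (1 : ℝ)) ω‖ ≤ 1 :=
    .of_forall fun ω => (norm_indicator_le_norm_self _ _).trans (by simp)
  have hS' : AEStronglyMeasurable[𝔉] (S.indicator (fun _ => (1 : ℝ))) P :=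
    (hSm.mono h𝒢).aestronglyMeasurable
  have hSint : Integrable (S.indicator (fun _ => (1 : ℝ))) P :=
    (integrable_const 1).indicator (h𝒢 _ hS)
  have hSX : Integrable (S.indicator (fun _ => (1 : ℝ)) * X) P := hX.bdd_mul hS' hS1
  have hSg : Integrable (P[X | ℋ] * S.indicator (fun _ => (1 : ℝ))) P :=
    integrable_condExp.mul_bdd hS' hS1
  have inner_step : P[S.indicator (fun _ => (1 : ℝ)) * X | 𝒢]
      =ᵐ[P] P[X | ℋ] * S.indicator (fun _ => (1 : ℝ)) := by
    filter_upwards [condExp_mul_of_stronglyMeasurable_left hSm hSX hX, hXind] with ω h1 h2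
    rw [h1, Pi.mul_apply, Pi.mul_apply, h2, mul_comm]
  exact (condExp_condExp_of_le hℋ𝒢 h𝒢).symm.trans ((condExp_congr_ae inner_step).trans
    (condExp_mul_of_stronglyMeasurable_left stronglyMeasurable_condExp hSg hSint))

/-- Theorem 3(i) (double robustness w.r.t. the propensity model): if the outcome-regression
function `m` is correctly specified, then for EVERY ℋ-measurable, possibly misspecified,
generalized propensity score `p̃` bounded away from 0 and 1, the DR estimand built from
`r̃ = p̃/(1−p̃)` equals the ATEM. -/
theorem atem_doubly_robust_in_propensity
    {Ω : Type*} {𝔉 : MeasurableSpace Ω} (P : Measure Ω) [IsProbabilityMeasure P]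
    (s t : ℕ) (hst : s < t)
    (Y0 : ℕ → Ω → ℝ) (hY0int : ∀ r, s ≤ r → r ≤ t → Integrable (Y0 r) P)
    (Yobs_t Yobs_s : Ω → ℝ) (hYt : Integrable Yobs_t P) (hYs : Integrable Yobs_s P)
    (ℋ 𝒟σ : MeasurableSpace Ω) (hℋ : ℋ ≤ 𝔉) (h𝒟 : 𝒟σ ≤ 𝔉)
    (M S : Set Ω) (hM : MeasurableSet[𝒟σ] M) (hS : MeasurableSet[𝒟σ] S)
    (hMS : Disjoint M S) (hPM : 0 < P M)
    (hcons_s : ∀ᵐ ω ∂P, ω ∈ M ∪ S → Yobs_s ω = Y0 s ω)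
    (hcons_t : ∀ᵐ ω ∂P, ω ∈ S → Yobs_t ω = Y0 t ω)
    (hpt : ∀ r, s < r → r ≤ t →
      P[fun ω => Y0 r ω - Y0 (r - 1) ω | 𝒟σ ⊔ ℋ]
        =ᵐ[P] P[fun ω => Y0 r ω - Y0 (r - 1) ω | ℋ])
    (ε : ℝ) (hε : 0 < ε)
    (hoverS : ∀ᵐ ω ∂P, ε ≤ (P[S.indicator (fun _ => (1 : ℝ)) | ℋ]) ω
        ∧ (P[S.indicator (fun _ => (1 : ℝ)) | ℋ]) ω ≤ 1 - ε)
    (m : Ω → ℝ) (hm_meas : Measurable[ℋ] m) (hm_int : Integrable m P)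
    (hm : (fun ω => m ω * (P[S.indicator (fun _ => (1 : ℝ)) | ℋ]) ω)
        =ᵐ[P] P[fun ω => S.indicator (fun _ => (1 : ℝ)) ω * (Yobs_t ω - Yobs_s ω) | ℋ]) :
    ∀ ptilde : Ω → ℝ, Measurable[ℋ] ptilde →
      (∃ ε' > (0 : ℝ), ∀ᵐ ω ∂P, ε' ≤ ptilde ω ∧ ptilde ω ≤ 1 - ε') →
      (∫ ω, (M.indicator (fun _ => (1 : ℝ)) ω / (P M).toReal
          - (ptilde ω / (1 - ptilde ω)) * S.indicator (fun _ => (1 : ℝ)) ω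
              / (∫ ω', (ptilde ω' / (1 - ptilde ω')) * S.indicator (fun _ => (1 : ℝ)) ω' ∂P))
          * ((Yobs_t ω - Yobs_s ω) - m ω) ∂P)
        = (∫ ω in M, (Yobs_t ω - Y0 t ω) ∂P) / (P M).toReal := by
  intro ptilde hp ⟨ε', hε', hpb⟩
  have hG : 𝒟σ ⊔ ℋ ≤ 𝔉 := sup_le h𝒟 hℋ
  have hMG : MeasurableSet[𝒟σ ⊔ ℋ] M := (le_sup_left : 𝒟σ ≤ 𝒟σ ⊔ ℋ) _ hM
  have hSG : MeasurableSet[𝒟σ ⊔ ℋ] S := (le_sup_left : 𝒟σ ≤ 𝒟σ ⊔ ℋ) _ hS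
  have hYt0 := hY0int t hst.le le_rfl
  have hX : Integrable (fun ω => Y0 t ω - Y0 s ω) P := hYt0.sub (hY0int s le_rfl hst.le)
  have hind := condExp_sub_eq_of_increments hst.le hY0int hpt
  -- the outcome regression is the conditional trend of the untreated outcome
  have hXm : P[fun ω => Y0 t ω - Y0 s ω | 𝒟σ ⊔ ℋ] =ᵐ[P] m := by
    have hSY : (fun ω => S.indicator (fun _ => (1 : ℝ)) ω * (Yobs_t ω - Yobs_s ω))
        =ᵐ[P] fun ω => S.indicator (fun _ => (1 : ℝ)) ω * (Y0 t ω - Y0 s ω) := by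
      filter_upwards [hcons_s, hcons_t] with ω h1 h2
      by_cases hω : ω ∈ S
      · rw [h1 (Or.inr hω), h2 hω]
      · simp [hω]
    have hfac := condExp_indicator_mul_of_meanIndep (le_sup_right : ℋ ≤ 𝒟σ ⊔ ℋ) hG hX hind hSG
    filter_upwards [hind, hm, condExp_congr_ae (m := ℋ) hSY, hfac, hoverS] with ω h1 h2 h3 h4 h5
    rw [h1]
    exact mul_right_cancel₀ (hε.trans_le h5.1).ne' (h4.symm.trans (h3.symm.trans h2.symm))
  set w : Ω → ℝ := fun ω => ptilde ω / (1 - ptilde ω) * S.indicator (fun _ => (1 : ℝ)) ω with hw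
  have hwm : StronglyMeasurable[𝒟σ ⊔ ℋ] w := by
    have hp' : Measurable[𝒟σ ⊔ ℋ] ptilde := hp.mono le_sup_right le_rfl
    exact ((hp'.div (measurable_const.sub hp')).mul
      (measurable_const.indicator hSG)).stronglyMeasurable
  have hwb : ∀ᵐ ω ∂P, ‖w ω‖ ≤ 1 / ε' := by
    filter_upwards [hpb] with ω ⟨h1, h2⟩
    have hodds : ‖ptilde ω / (1 - ptilde ω)‖ ≤ 1 / ε' := by
      rw [Real.norm_of_nonneg (div_nonneg (by linarith) (by linarith))]
      exact div_le_div₀ zero_le_one (by linarith) hε' (by linarith)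
    have hone : ‖S.indicator (fun _ => (1 : ℝ)) ω‖ ≤ 1 :=
      (norm_indicator_le_norm_self _ _).trans (by simp)
    calc ‖w ω‖ = ‖ptilde ω / (1 - ptilde ω)‖ * ‖S.indicator (fun _ => (1 : ℝ)) ω‖ := norm_mul _ _
      _ ≤ 1 / ε' * 1 := mul_le_mul hodds hone (norm_nonneg _) (by positivity)
      _ = 1 / ε' := mul_one _
  have hMm : StronglyMeasurable[𝒟σ ⊔ ℋ] (M.indicator (fun _ => (1 : ℝ))) :=
    stronglyMeasurable_const.indicator hMG
  have hMb : ∀ᵐ ω ∂P, ‖M.indicator (fun _ => (1 : ℝ)) ω‖ ≤ 1 :=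
    .of_forall fun ω => (norm_indicator_le_norm_self _ _).trans (by simp)
  have hstay := integral_mul_sub_condExp_eq_zero hG hX hm_int hXm hwm hwb
  have hmove := integral_mul_sub_condExp_eq_zero hG hX hm_int hXm hMm hMb
  have hstay_int : Integrable (fun ω => w ω * (Y0 t ω - Y0 s ω - m ω)) P :=
    (hX.sub hm_int).bdd_mul (hwm.mono hG).aestronglyMeasurable hwb
  have hmove_int : Integrable
      (fun ω => M.indicator (fun _ => (1 : ℝ)) ω * (Y0 t ω - Y0 s ω - m ω)) P :=
    (hX.sub hm_int).bdd_mul (hMm.mono hG).aestronglyMeasurable hMb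
  have heff_int : Integrable (M.indicator fun ω => Yobs_t ω - Y0 t ω) P :=
    (hYt.sub hYt0).indicator (hG _ hMG)
  have hsum_int : Integrable (fun ω => M.indicator (fun ω => Yobs_t ω - Y0 t ω) ω
      + M.indicator (fun _ => (1 : ℝ)) ω * (Y0 t ω - Y0 s ω - m ω)) P :=
    heff_int.add hmove_int
  set c : ℝ := ∫ ω, w ω ∂P
  have hdecomp : (fun ω => (M.indicator (fun _ => (1 : ℝ)) ω / (P M).toReal - w ω / c)
        * ((Yobs_t ω - Yobs_s ω) - m ω))
      =ᵐ[P] fun ω => (M.indicator (fun ω => Yobs_t ω - Y0 t ω) ω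
        + M.indicator (fun _ => (1 : ℝ)) ω * (Y0 t ω - Y0 s ω - m ω)) / (P M).toReal
        - w ω * (Y0 t ω - Y0 s ω - m ω) / c := by
    filter_upwards [hcons_s, hcons_t] with ω h1 h2
    by_cases hωM : ω ∈ M
    · have hwω : w ω = 0 := by simp [hw, Set.disjoint_left.mp hMS hωM]
      rw [hwω, h1 (Or.inl hωM)]
      simp only [Set.indicator_of_mem hωM]
      ring
    · by_cases hωS : ω ∈ S
      · rw [h1 (Or.inr hωS), h2 hωS]
        simp only [Set.indicator_of_notMem hωM]
        ring
      · simp [hw, hωM, hωS]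
  rw [integral_congr_ae hdecomp,
    integral_sub (hsum_int.div_const _) (hstay_int.div_const _),
    integral_div, integral_div, integral_add heff_int hmove_int, hmove, hstay,
    integral_indicator (hG _ hMG)]
  simp
end
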